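/- Let n ≥ 1 and 1 ≤ r ≤ 2n be integers with r ≤ n, let A be a uniformly random r-element subset of the 2n-element set [n] × {0,1}, and let Y = |{j ∈ [n] : (j,0) ∈ A and (j,1) ∈ A}|. Then for every integer t ≥ 1, Pr[Y ≥ t] ≤ (e·r²/(4·n·t))^t. -/

import Mathlib

/-- The number of complete pairs `{(j,0),(j,1)}` contained in a subset `A` of `[n] × {0,1}`. -/
def pairCount (n : ℕ) (A : Finset (Fin n × Bool)) : ℕ :=
  (Finset.univ.filter (fun j : Fin n => (j, false) ∈ A ∧ (j, true) ∈ A)).card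

theorem count_aux (n r t : ℕ) :
    (((Finset.univ : Finset (Fin n × Bool)).powersetCard r).filter
          (fun A => t ≤ pairCount n A)).card ≤ n.choose t * (2 * n - 2 * t).choose (r - 2 * t) := by
  classical
  have hsub : (((Finset.univ : Finset (Fin n × Bool)).powersetCard r).filter
          (fun A => t ≤ pairCount n A)) ⊆
      ((Finset.univ : Finset (Fin n)).powersetCard t).biUnion (fun S =>
        ((Finset.univ : Finset (Fin n × Bool)).powersetCard r).filter
          (fun A => S ×ˢ (Finset.univ : Finset Bool) ⊆ A)) := by
    intro A hA
    rw [Finset.mem_filter] at hA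
    obtain ⟨hA, h⟩ := hA
    obtain ⟨S, hS, hc⟩ := Finset.exists_subset_card_eq h
    rw [Finset.mem_biUnion]
    refine ⟨S, by simp [Finset.mem_powersetCard, hc], ?_⟩
    rw [Finset.mem_filter]
    refine ⟨hA, ?_⟩
    rintro ⟨j, b⟩ hj
    have hj1 := hS (Finset.mem_product.1 hj).1
    rw [Finset.mem_filter] at hj1
    cases b
    · exact hj1.2.1
    · exact hj1.2.2
  refine (Finset.card_le_card hsub).trans ?_
  refine (Finset.card_biUnion_le_card_mul _ _ ((2 * n - 2 * t).choose (r - 2 * t)) ?_).trans ?_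
  · intro S hS
    rw [Finset.mem_powersetCard] at hS
    have hP : (S ×ˢ (Finset.univ : Finset Bool)).card = 2 * t := by
      rw [Finset.card_product, hS.2]; simp [mul_comm]
    have hQ : (Finset.univ \ (S ×ˢ (Finset.univ : Finset Bool))).card = 2 * n - 2 * t := by
      rw [Finset.card_sdiff_of_subset (Finset.subset_univ _), hP]; simp [mul_comm]
    rw [← hQ, ← Finset.card_powersetCard]
    refine Finset.card_le_card_of_injOn (fun A => A \ (S ×ˢ (Finset.univ : Finset Bool))) ?_ ?_
    · intro A hA
      simp only [Finset.coe_filter, Set.mem_ofPred_eq, Finset.mem_powersetCard] at hA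
      simp only [Finset.mem_coe, Finset.mem_powersetCard]
      refine ⟨Finset.sdiff_subset_sdiff (Finset.subset_univ _) (Finset.Subset.refl _), ?_⟩
      rw [Finset.card_sdiff_of_subset hA.2, hP, hA.1.2]
    · intro A hA B hB hAB
      simp only [Finset.coe_filter, Set.mem_ofPred_eq] at hA hB
      simp only at hAB
      rw [← Finset.sdiff_union_of_subset hA.2, hAB, Finset.sdiff_union_of_subset hB.2]
  · simp

theorem step_aux (n r t : ℕ) (hr : r ≤ n) (h : 2 * (t + 1) ≤ r) :
    n.choose (t+1) * (2 * n - 2 * (t+1)).choose (r - 2 * (t+1)) * (t+1).factorial * (4 * n)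
      ≤ r ^ 2 * (n.choose t * (2 * n - 2 * t).choose (r - 2 * t) * t.factorial) := by
  obtain ⟨k, rfl⟩ := Nat.exists_eq_add_of_le h
  obtain ⟨m, rfl⟩ := Nat.exists_eq_add_of_le hr
  have e1 : 2 * (2 * (t + 1) + k + m) - 2 * (t+1) = 2 * t + 2 + 2 * k + 2 * m := by omega
  have e2 : 2 * (2 * (t + 1) + k + m) - 2 * t = 2 * t + 2 + 2 * k + 2 * m + 1 + 1 := by omega
  have e3 : 2 * (t + 1) + k - 2 * (t+1) = k := by omega
  have e4 : 2 * (t + 1) + k - 2 * t = k + 1 + 1 := by omega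
  rw [e1, e2, e3, e4, Nat.factorial_succ]
  have h1 := Nat.choose_succ_right_eq (2 * (t + 1) + k + m) t
  have e5 : 2 * (t + 1) + k + m - t = t + 2 + k + m := by omega
  rw [e5] at h1
  have h2 := Nat.add_one_mul_choose_eq (2 * t + 2 + 2 * k + 2 * m) k
  have h3 := Nat.add_one_mul_choose_eq (2 * t + 2 + 2 * k + 2 * m + 1) (k + 1)
  generalize (2 * (t + 1) + k + m).choose (t+1) = a at *
  generalize (2 * (t + 1) + k + m).choose t = b at *
  generalize (2 * t + 2 + 2 * k + 2 * m).choose k = c at *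
  generalize (2 * t + 2 + 2 * k + 2 * m + 1).choose (k+1) = d at *
  generalize (2 * t + 2 + 2 * k + 2 * m + 1 + 1).choose (k+1+1) = f at *
  generalize t.factorial = g at *
  refine le_of_mul_le_mul_left (a := 2 * t + 2 + 2 * k + 2 * m + 1) ?_ (Nat.succ_pos _)
  have key : (k + 2) * (k + 1) * (2 * (2 * (t + 1) + k + m)) ≤
      (2 * t + 2 + 2 * k + 2 * m + 1) * (2 * (t + 1) + k) ^ 2 := by
    -- write N = r + m, s = 2t+1, r = k+1+s
    have a1 : (k + 2) * (k + 1) ≤ (2 * (t + 1) + k) * (k + 1) :=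
      Nat.mul_le_mul_right _ (by omega)
    have a2 : (k + 1) * (2 * (2 * (t + 1) + k + m)) ≤
        (2 * t + 2 + 2 * k + 2 * m + 1) * (2 * (t + 1) + k) := by
      nlinarith [Nat.zero_le (t * m), Nat.zero_le (t * k), Nat.zero_le (t * t)]
    calc _ ≤ (2 * (t + 1) + k) * (k + 1) * (2 * (2 * (t + 1) + k + m)) :=
          Nat.mul_le_mul_right _ a1
      _ = (2 * (t + 1) + k) * ((k + 1) * (2 * (2 * (t + 1) + k + m))) := by ring
      _ ≤ (2 * (t + 1) + k) * ((2 * t + 2 + 2 * k + 2 * m + 1) * (2 * (t + 1) + k)) :=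
          Nat.mul_le_mul_left _ a2
      _ = _ := by ring
  calc _ = (a * (t+1)) * ((2 * t + 2 + 2 * k + 2 * m + 1) * c) * g * (4 * (2 * (t + 1) + k + m)) := by ring
    _ = ((2 * t + 2 + 2 * k + 2 * m + 1 + 1) * d) * (k+1) * b * g * (2 * (2 * (t + 1) + k + m)) := by
      rw [h1, h2]; ring
    _ = ((k + 2) * (k + 1) * (2 * (2 * (t + 1) + k + m))) * (f * b * g) := by
      rw [h3]; ring
    _ ≤ ((2 * t + 2 + 2 * k + 2 * m + 1) * (2 * (t + 1) + k) ^ 2) * (f * b * g) :=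
      Nat.mul_le_mul_right _ key
    _ = _ := by ring

theorem main_aux (n r t : ℕ) (hr : r ≤ n) (h : 2 * t ≤ r) :
    n.choose t * (2 * n - 2 * t).choose (r - 2 * t) * t.factorial * (4 * n) ^ t
      ≤ (r ^ 2) ^ t * (2 * n).choose r := by
  induction t with
  | zero => simp
  | succ t ih =>
    have h1 := step_aux n r t hr h
    have h2 := ih (by omega)
    calc _ = n.choose (t+1) * (2 * n - 2 * (t+1)).choose (r - 2 * (t+1)) * (t+1).factorial * (4 * n)
              * (4 * n) ^ t := by ring
      _ ≤ r ^ 2 * (n.choose t * (2 * n - 2 * t).choose (r - 2 * t) * t.factorial) * (4 * n) ^ t :=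
        Nat.mul_le_mul_right _ h1
      _ = r ^ 2 * (n.choose t * (2 * n - 2 * t).choose (r - 2 * t) * t.factorial * (4 * n) ^ t) := by
        ring
      _ ≤ r ^ 2 * ((r ^ 2) ^ t * (2 * n).choose r) := Nat.mul_le_mul_left _ h2
      _ = _ := by ring

theorem zero_aux (n r t : ℕ) (h : r < 2 * t) :
    (((Finset.univ : Finset (Fin n × Bool)).powersetCard r).filter
          (fun A => t ≤ pairCount n A)).card = 0 := by
  classical
  rw [Finset.card_eq_zero, Finset.filter_eq_empty_iff]
  intro A hA ht
  rw [Finset.mem_powersetCard] at hA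
  have : (Finset.univ.filter (fun j : Fin n => (j, false) ∈ A ∧ (j, true) ∈ A)) ×ˢ
      (Finset.univ : Finset Bool) ⊆ A := by
    rintro ⟨j, b⟩ hj
    have hj1 := (Finset.mem_product.1 hj).1
    rw [Finset.mem_filter] at hj1
    cases b
    · exact hj1.2.1
    · exact hj1.2.2
  have h2 := Finset.card_le_card this
  rw [Finset.card_product, hA.2] at h2
  unfold pairCount at ht
  simp only [Finset.card_univ, Fintype.card_bool] at h2
  omega

/-- For a uniformly random `r`-element subset `A` of `[n] × {0,1}` with `r ≤ n`, and `Y` the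
number of complete pairs in `A`, we have `Pr[Y ≥ t] ≤ (e·r²/(4nt))^t` for every `t ≥ 1`. -/
theorem stmt_12 (n r t : ℕ) (hn : 1 ≤ n) (hr1 : 1 ≤ r) (hr2 : r ≤ 2 * n) (hr3 : r ≤ n)
    (ht : 1 ≤ t) :
    ((((Finset.univ : Finset (Fin n × Bool)).powersetCard r).filter
          (fun A => t ≤ pairCount n A)).card : ℝ) /
        (((Finset.univ : Finset (Fin n × Bool)).powersetCard r).card : ℝ) ≤
      (Real.exp 1 * (r : ℝ) ^ 2 / (4 * (n : ℝ) * (t : ℝ))) ^ t := by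
  rcases lt_or_ge r (2 * t) with h | h
  · rw [zero_aux n r t h]
    simp only [Nat.cast_zero, zero_div]
    positivity
  have hN : ((Finset.univ : Finset (Fin n × Bool)).powersetCard r).card = (2 * n).choose r := by
    rw [Finset.card_powersetCard]; simp [mul_comm]
  have hc := count_aux n r t
  rw [hN]
  generalize (((Finset.univ : Finset (Fin n × Bool)).powersetCard r).filter
          (fun A => t ≤ pairCount n A)).card = X at *
  have h1 : X * t.factorial * (4 * n) ^ t ≤ (r ^ 2) ^ t * (2 * n).choose r :=
    le_trans (by gcongr) (main_aux n r t hr3 h)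
  have hC : 0 < (2 * n).choose r := Nat.choose_pos hr2
  have h2 : (X : ℝ) * t.factorial * (4 * n) ^ t ≤ (r ^ 2) ^ t * ((2 * n).choose r : ℕ) := by
    exact_mod_cast h1
  have h3 := Real.pow_div_factorial_le_exp (t : ℝ) (by positivity) t
  rw [div_le_iff₀ (by positivity)] at h3
  have h4 : Real.exp (t : ℝ) = Real.exp 1 ^ t := by
    rw [← Real.exp_nat_mul]; simp
  rw [h4] at h3
  have hC' : (0 : ℝ) < ((2 * n).choose r : ℕ) := by exact_mod_cast hC
  have hn' : (0 : ℝ) < n := by exact_mod_cast hn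
  have ht' : (0 : ℝ) < t := by exact_mod_cast ht
  rw [div_pow, div_le_div_iff₀ hC' (by positivity), mul_pow _ (t : ℝ), mul_pow (Real.exp 1)]
  calc (X : ℝ) * ((4 * n) ^ t * (t : ℝ) ^ t)
      ≤ X * ((4 * n) ^ t * (Real.exp 1 ^ t * t.factorial)) := by gcongr
    _ = Real.exp 1 ^ t * (X * t.factorial * (4 * n) ^ t) := by ring
    _ ≤ Real.exp 1 ^ t * ((r ^ 2) ^ t * ((2 * n).choose r : ℕ)) := by gcongr
    _ = _ := by ring
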